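/- Let X = {1, 3, 5, 7.02, 9.02, 11.02, 17, 18, 19, 20, 22.01, 23.01, 24.01, 25.01} ⊂ ℝ with the metric d(x,y) = |x − y| and let N_p = 2. Then both of the following 3-clusterings of X are weakly separable for N_p = 2: C = {{1, 3, 5, 7.02, 9.02, 11.02}, {17, 18, 19, 20}, {22.01, 23.01, 24.01, 25.01}} and C' = {{1, 3, 5}, {7.02, 9.02, 11.02}, {17, 18, 19, 20, 22.01, 23.01, 24.01, 25.01}}. In particular, since C ≠ C', X does not have a unique weakly separable 3-clustering for N_p = 2. -/

import Mathlib

variable {α : Type*}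

/-- Sparsity ε_{N_p}(x): smallest ε ≥ 0 such that at least N_p points of X lie within
distance ε of x. -/
noncomputable def sparsity [MetricSpace α] (X : Finset α) (Np : ℕ) (x : α) : ℝ :=
  sInf {ε : ℝ | 0 ≤ ε ∧ Np ≤ (X.filter (fun y => dist x y ≤ ε)).card}

/-- x is ε-connected to y: there is a finite sequence of points of X from x to y,
each of sparsity at most ε, with consecutive distances at most ε. -/
def EpsConn [MetricSpace α] (X : Finset α) (Np : ℕ) (ε : ℝ) (x y : α) : Prop :=
  x ∈ X ∧ sparsity X Np x ≤ ε ∧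
    Relation.ReflTransGen (fun a b => b ∈ X ∧ sparsity X Np b ≤ ε ∧ dist a b ≤ ε) x y

/-- A set c is ε-connected if every pair of points of c is ε-connected. -/
def SetConn [MetricSpace α] (X : Finset α) (Np : ℕ) (ε : ℝ) (c : Finset α) : Prop :=
  ∀ x ∈ c, ∀ y ∈ c, EpsConn X Np ε x y

/-- ε*(c): the minimum ε such that c is ε-connected. -/
noncomputable def setSparsity [MetricSpace α] (X : Finset α) (Np : ℕ) (c : Finset α) : ℝ :=
  sInf {ε : ℝ | SetConn X Np ε c}

/-- ε(x,y): the minimum ε such that x is ε-connected to y. -/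
noncomputable def epsDist [MetricSpace α] (X : Finset α) (Np : ℕ) (x y : α) : ℝ :=
  sInf {ε : ℝ | EpsConn X Np ε x y}

/-- ε(x,c): min over y ∈ c of ε(x,y). -/
noncomputable def ptClusterDist [MetricSpace α] (X : Finset α) (Np : ℕ) (x : α)
    (c : Finset α) : ℝ :=
  sInf {e : ℝ | ∃ y ∈ c, e = epsDist X Np x y}

/-- ε(c,c'): min over x ∈ c, y ∈ c' of ε(x,y). -/
noncomputable def clusterDist [MetricSpace α] (X : Finset α) (Np : ℕ)
    (c c' : Finset α) : ℝ :=
  sInf {e : ℝ | ∃ x ∈ c, ∃ y ∈ c', e = epsDist X Np x y}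

/-- A clustering of X: a partition of X into nonempty clusters. -/
def IsClustering (X : Finset α) (C : Finset (Finset α)) : Prop :=
  (∀ c ∈ C, c.Nonempty) ∧ (∀ c ∈ C, ∀ c' ∈ C, c ≠ c' → Disjoint c c') ∧
    (∀ c ∈ C, c ⊆ X) ∧ (∀ x ∈ X, ∃ c ∈ C, x ∈ c)

/-- C is weakly separable: for each cluster c, ε*(c) < min over c' ≠ c of ε(c,c'). -/
def WeaklySeparable [MetricSpace α] (X : Finset α) (Np : ℕ) (C : Finset (Finset α)) : Prop :=
  ∀ c ∈ C, ∀ c' ∈ C, c' ≠ c → setSparsity X Np c < clusterDist X Np c c'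

/-- c is an ε-cluster: a (nonempty) maximal ε-connected subset of X. -/
def IsEpsCluster [MetricSpace α] (X : Finset α) (Np : ℕ) (ε : ℝ) (c : Finset α) : Prop :=
  c.Nonempty ∧ SetConn X Np ε c ∧ ∀ x ∈ X, (∃ y ∈ c, EpsConn X Np ε x y) → x ∈ c

/-- c is a maximal cluster: an ε-cluster for some ε ≥ 0. -/
def IsMaximalCluster [MetricSpace α] (X : Finset α) (Np : ℕ) (c : Finset α) : Prop :=
  ∃ ε : ℝ, 0 ≤ ε ∧ IsEpsCluster X Np ε c

/-- x is a local maximum: every y ∈ X with d(x,y) ≤ ε_{N_p}(x) has sparsity ≥ that of x. -/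
def IsLocalMaxPt [MetricSpace α] (X : Finset α) (Np : ℕ) (x : α) : Prop :=
  x ∈ X ∧ ∀ y ∈ X, dist x y ≤ sparsity X Np x → sparsity X Np x ≤ sparsity X Np y

/-- X_c*: the points of c of minimum sparsity within c. -/
noncomputable def minSparsityPts [MetricSpace α] (X : Finset α) (Np : ℕ)
    (c : Finset α) : Finset α :=
  c.filter (fun x => ∀ y ∈ c, sparsity X Np x ≤ sparsity X Np y)

/-- Relative separability A(x,y) = ε(x,y) / ε_{N_p}(x). -/
noncomputable def relSep [MetricSpace α] (X : Finset α) (Np : ℕ) (x y : α) : ℝ :=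
  epsDist X Np x y / sparsity X Np x

/-- A(x,c) = min over y ∈ c of A(x,y). -/
noncomputable def relSepCluster [MetricSpace α] (X : Finset α) (Np : ℕ) (x : α)
    (c : Finset α) : ℝ :=
  sInf {a : ℝ | ∃ y ∈ c, a = relSep X Np x y}

/-- A^ℓ(C): the minimum A such that for every local maximum x, every y in the cluster of x
with sparsity at most that of x satisfies A(x,y) ≤ A. -/
noncomputable def Aell [MetricSpace α] (X : Finset α) (Np : ℕ)
    (C : Finset (Finset α)) : ℝ :=
  sInf {A : ℝ | ∀ x ∈ X, IsLocalMaxPt X Np x → ∀ c ∈ C, x ∈ c →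
    ∀ y ∈ c, sparsity X Np y ≤ sparsity X Np x → relSep X Np x y ≤ A}

/-- C is LM-separable: A^ℓ(C) < min over distinct clusters c, c' and z ∈ X_c* of A(z,c'). -/
def LMSeparable [MetricSpace α] (X : Finset α) (Np : ℕ) (C : Finset (Finset α)) : Prop :=
  ∀ c ∈ C, ∀ c' ∈ C, c ≠ c' → ∀ z ∈ minSparsityPts X Np c,
    Aell X Np C < relSepCluster X Np z c'

/-- min over x ∈ c of ε_{N_p}(x). -/
noncomputable def minSpars [MetricSpace α] (X : Finset α) (Np : ℕ) (c : Finset α) : ℝ :=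
  sInf (sparsity X Np '' (c : Set α))

/-- max over x ∈ c of ε_{N_p}(x). -/
noncomputable def maxSpars [MetricSpace α] (X : Finset α) (Np : ℕ) (c : Finset α) : ℝ :=
  sSup (sparsity X Np '' (c : Set α))

/-- C is strongly separable: there is an A such that each cluster c is
(A · min sparsity of c)-connected and A · min sparsity of c < min over c' ≠ c of ε(c,c'). -/
def StronglySeparable [MetricSpace α] (X : Finset α) (Np : ℕ)
    (C : Finset (Finset α)) : Prop :=
  ∃ A : ℝ, ∀ c ∈ C, SetConn X Np (A * minSpars X Np c) c ∧
    ∀ c' ∈ C, c' ≠ c → A * minSpars X Np c < clusterDist X Np c c'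

/-- c*(x,ε): the set of points of X that are ε-connected to x. -/
def epsClusterAt [MetricSpace α] (X : Finset α) (Np : ℕ) (ε : ℝ) (x : α) : Set α :=
  {y | EpsConn X Np ε x y}

/-- The 14-point example dataset. -/
noncomputable def Xex : Finset ℝ :=
  {1, 3, 5, 7.02, 9.02, 11.02, 17, 18, 19, 20, 22.01, 23.01, 24.01, 25.01}

/-- The first 3-clustering of the example dataset. -/
noncomputable def CexA : Finset (Finset ℝ) :=
  {({1, 3, 5, 7.02, 9.02, 11.02} : Finset ℝ), ({17, 18, 19, 20} : Finset ℝ),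
    ({22.01, 23.01, 24.01, 25.01} : Finset ℝ)}

/-- The second 3-clustering of the example dataset. -/
noncomputable def CexB : Finset (Finset ℝ) :=
  {({1, 3, 5} : Finset ℝ), ({7.02, 9.02, 11.02} : Finset ℝ),
    ({17, 18, 19, 20, 22.01, 23.01, 24.01, 25.01} : Finset ℝ)}

section EpsConnectivity

variable [MetricSpace α] {X : Finset α} {Np : ℕ} {ε : ℝ} {x y z : α} {c c' : Finset α}

theorem sparsity_nonneg (X : Finset α) (Np : ℕ) (x : α) : 0 ≤ sparsity X Np x :=
  Real.sInf_nonneg fun _ h => h.1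

theorem sparsity_two_le (hx : x ∈ X) (hy : y ∈ X) (hxy : x ≠ y) (h : dist x y ≤ ε) :
    sparsity X 2 x ≤ ε := by
  classical
  have hε : 0 ≤ ε := dist_nonneg.trans h
  refine csInf_le ⟨0, fun _ h => h.1⟩ ⟨hε, ?_⟩
  rw [← Finset.card_pair hxy]
  refine Finset.card_le_card fun w hw => ?_
  rcases Finset.mem_insert.1 hw with rfl | hw
  · simp [hx, hε]
  · rw [Finset.mem_singleton.1 hw]
    simp [hy, h]

theorem EpsConn.nonneg (h : EpsConn X Np ε x y) : 0 ≤ ε :=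
  (sparsity_nonneg X Np x).trans h.2.1

theorem EpsConn.refl (hx : x ∈ X) (h : sparsity X Np x ≤ ε) : EpsConn X Np ε x x :=
  ⟨hx, h, .refl⟩

theorem EpsConn.trans (h : EpsConn X Np ε x y) (h' : EpsConn X Np ε y z) :
    EpsConn X Np ε x z :=
  ⟨h.1, h.2.1, h.2.2.trans h'.2.2⟩

theorem EpsConn.symm (h : EpsConn X Np ε x y) : EpsConn X Np ε y x := by
  obtain ⟨hx, hs, h⟩ := h
  induction h with
  | refl => exact .refl hx hs
  | tail _ h ih =>
    exact ⟨h.1, h.2.1, .head ⟨ih.1, ih.2.1, by rw [dist_comm]; exact h.2.2⟩ ih.2.2⟩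

theorem epsConn_two_of_dist_le (hx : x ∈ X) (hy : y ∈ X) (hxy : x ≠ y) (h : dist x y ≤ ε) :
    EpsConn X 2 ε x y :=
  ⟨hx, sparsity_two_le hx hy hxy h,
    .single ⟨hy, sparsity_two_le hy hx hxy.symm (by rwa [dist_comm]), h⟩⟩

theorem setConn_singleton (h : EpsConn X Np ε x y) : SetConn X Np ε {x} := by
  intro a ha b hb
  rw [Finset.mem_singleton.1 ha, Finset.mem_singleton.1 hb]
  exact .refl h.1 h.2.1

theorem setConn_insert [DecidableEq α] (hc : SetConn X Np ε c) (hy : y ∈ c)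
    (h : EpsConn X Np ε x y) : SetConn X Np ε (insert x c) := by
  have key : ∀ a ∈ insert x c, EpsConn X Np ε a y := by
    intro a ha
    rcases Finset.mem_insert.1 ha with rfl | ha
    · exact h
    · exact hc a ha y hy
  exact fun a ha b hb => (key a ha).trans (key b hb).symm

theorem SetConn.setSparsity_le (h : SetConn X Np ε c) (hc : c.Nonempty) :
    setSparsity X Np c ≤ ε := by
  obtain ⟨x, hx⟩ := hc
  exact csInf_le ⟨0, fun _ h => (h x hx x hx).nonneg⟩ h

theorem le_clusterDist {r s : ℝ} (hs : SetConn X Np s X) (hcX : c ⊆ X) (hcX' : c' ⊆ X)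
    (hc : c.Nonempty) (hc' : c'.Nonempty)
    (h : ∀ x ∈ c, ∀ y ∈ c', ∀ ε, EpsConn X Np ε x y → r ≤ ε) :
    r ≤ clusterDist X Np c c' := by
  obtain ⟨x, hx⟩ := hc
  obtain ⟨y, hy⟩ := hc'
  refine le_csInf ⟨_, x, hx, y, hy, rfl⟩ ?_
  rintro _ ⟨x, hx, y, hy, rfl⟩
  exact le_csInf ⟨s, hs x (hcX hx) y (hcX' hy)⟩ (h x hx y hy)

end EpsConnectivity

theorem EpsConn.gap_le {X : Finset ℝ} {Np : ℕ} {ε p q x y : ℝ}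
    (hX : ∀ z ∈ X, z ≤ p ∨ q ≤ z) (h : EpsConn X Np ε x y) (hx : x ≤ p) (hy : q ≤ y) :
    q - p ≤ ε := by
  by_contra! hlt
  have hε := h.nonneg
  have key : y ≤ p := by
    obtain ⟨_, _, h⟩ := h
    clear hy
    induction h with
    | refl => exact hx
    | tail _ h ih =>
      rcases hX _ h.1 with h' | h'
      · exact h'
      · have := (abs_le.1 (Real.dist_eq _ _ ▸ h.2.2)).1
        linarith
  linarith

theorem setSparsity_lt_clusterDist_of_gap {X c c' : Finset ℝ} {Np : ℕ} {δ s : ℝ} (p q : ℝ)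
    (hs : SetConn X Np s X) (hcX : c ⊆ X) (hcX' : c' ⊆ X) (hc : c.Nonempty) (hc' : c'.Nonempty)
    (hδ : SetConn X Np δ c) (hpq : δ < q - p) (hX : ∀ z ∈ X, z ≤ p ∨ q ≤ z)
    (h : (∀ x ∈ c, x ≤ p) ∧ (∀ y ∈ c', q ≤ y) ∨ (∀ x ∈ c, q ≤ x) ∧ ∀ y ∈ c', y ≤ p) :
    setSparsity X Np c < clusterDist X Np c c' := by
  refine ((hδ.setSparsity_le hc).trans_lt hpq).trans_le
    (le_clusterDist hs hcX hcX' hc hc' fun x hx y hy ε hε => ?_)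
  rcases h with h | h
  · exact hε.gap_le hX (h.1 x hx) (h.2 y hy)
  · exact hε.symm.gap_le hX (h.2 y hy) (h.1 x hx)

theorem isClustering_CexA : IsClustering Xex CexA := by
  refine ⟨?_, ?_, ?_, ?_⟩
  · simp [CexA]
  · simp only [CexA, Finset.mem_insert, Finset.mem_singleton]
    rintro c (rfl | rfl | rfl) c' (rfl | rfl | rfl) h <;>
      first
        | exact absurd rfl h
        | (clear h; norm_num [Finset.disjoint_left])
  · simp only [CexA, Finset.mem_insert, Finset.mem_singleton]
    rintro c (rfl | rfl | rfl) <;> simp [Xex, Finset.insert_subset_iff]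
  · simp only [Xex, CexA, Finset.mem_insert, Finset.mem_singleton, exists_eq_or_imp,
      exists_eq_left]
    tauto

theorem isClustering_CexB : IsClustering Xex CexB := by
  refine ⟨?_, ?_, ?_, ?_⟩
  · simp [CexB]
  · simp only [CexB, Finset.mem_insert, Finset.mem_singleton]
    rintro c (rfl | rfl | rfl) c' (rfl | rfl | rfl) h <;>
      first
        | exact absurd rfl h
        | (clear h; norm_num [Finset.disjoint_left])
  · simp only [CexB, Finset.mem_insert, Finset.mem_singleton]
    rintro c (rfl | rfl | rfl) <;> simp [Xex, Finset.insert_subset_iff]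
  · simp only [Xex, CexB, Finset.mem_insert, Finset.mem_singleton, exists_eq_or_imp,
      exists_eq_left]
    tauto

theorem card_CexA : CexA.card = 3 := by
  refine Finset.card_eq_three.2 ⟨_, _, _, ?_, ?_, ?_, rfl⟩
  · exact fun h => by have := Finset.ext_iff.1 h 1; norm_num at this
  · exact fun h => by have := Finset.ext_iff.1 h 1; norm_num at this
  · exact fun h => by have := Finset.ext_iff.1 h 17; norm_num at this

theorem card_CexB : CexB.card = 3 := by
  refine Finset.card_eq_three.2 ⟨_, _, _, ?_, ?_, ?_, rfl⟩
  · exact fun h => by have := Finset.ext_iff.1 h 1; norm_num at this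
  · exact fun h => by have := Finset.ext_iff.1 h 1; norm_num at this
  · exact fun h => by have := Finset.ext_iff.1 h 17; norm_num at this

theorem CexA_ne_CexB : CexA ≠ CexB := by
  intro h
  have h1 : ({17, 18, 19, 20} : Finset ℝ) ∈ CexB := h ▸ by simp [CexA]
  simp only [CexB, Finset.mem_insert, Finset.mem_singleton] at h1
  rcases h1 with h1 | h1 | h1
  · have := Finset.ext_iff.1 h1 17; norm_num at this
  · have := Finset.ext_iff.1 h1 17; norm_num at this
  · have := Finset.ext_iff.1 h1 25.01; norm_num at this

theorem epsConn_Xex_of_sub_le {ε x y : ℝ} (hx : x ∈ Xex) (hy : y ∈ Xex) (hxy : x < y)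
    (h : y - x ≤ ε) : EpsConn Xex 2 ε x y :=
  epsConn_two_of_dist_le hx hy hxy.ne (by rwa [dist_comm, Real.dist_eq, abs_of_pos (sub_pos.2 hxy)])

theorem setConn_pair_Xex {ε x y : ℝ} (hx : x ∈ Xex) (hy : y ∈ Xex) (hxy : x < y)
    (h : y - x ≤ ε) : SetConn Xex 2 ε {x, y} :=
  have hc := epsConn_Xex_of_sub_le hx hy hxy h
  setConn_insert (setConn_singleton hc.symm) (Finset.mem_singleton_self y) hc

theorem setConn_insert_Xex {ε x y : ℝ} {c : Finset ℝ} (hc : SetConn Xex 2 ε (insert y c))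
    (hx : x ∈ Xex) (hy : y ∈ Xex) (hxy : x < y) (h : y - x ≤ ε) :
    SetConn Xex 2 ε (insert x (insert y c)) :=
  setConn_insert hc (Finset.mem_insert_self y c) (epsConn_Xex_of_sub_le hx hy hxy h)

theorem setConn_Xex : SetConn Xex 2 6 Xex := by
  suffices h : SetConn Xex 2 6
      {1, 3, 5, 7.02, 9.02, 11.02, 17, 18, 19, 20, 22.01, 23.01, 24.01, 25.01} from h
  iterate 12
    refine setConn_insert_Xex ?_ (by simp [Xex]) (by simp [Xex]) (by norm_num) (by norm_num)
  exact setConn_pair_Xex (by simp [Xex]) (by simp [Xex]) (by norm_num) (by norm_num)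

theorem weaklySeparable_CexA : WeaklySeparable Xex 2 CexA := by
  have h1 : SetConn Xex 2 2.02 {1, 3, 5, 7.02, 9.02, 11.02} := by
    iterate 4
      refine setConn_insert_Xex ?_ (by simp [Xex]) (by simp [Xex]) (by norm_num) (by norm_num)
    exact setConn_pair_Xex (by simp [Xex]) (by simp [Xex]) (by norm_num) (by norm_num)
  have h2 : SetConn Xex 2 1 {17, 18, 19, 20} := by
    iterate 2
      refine setConn_insert_Xex ?_ (by simp [Xex]) (by simp [Xex]) (by norm_num) (by norm_num)
    exact setConn_pair_Xex (by simp [Xex]) (by simp [Xex]) (by norm_num) (by norm_num)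
  have h3 : SetConn Xex 2 1 {22.01, 23.01, 24.01, 25.01} := by
    iterate 2
      refine setConn_insert_Xex ?_ (by simp [Xex]) (by simp [Xex]) (by norm_num) (by norm_num)
    exact setConn_pair_Xex (by simp [Xex]) (by simp [Xex]) (by norm_num) (by norm_num)
  have gap1 : ∀ z ∈ Xex, z ≤ 11.02 ∨ 17 ≤ z := by norm_num [Xex]
  have gap2 : ∀ z ∈ Xex, z ≤ 20 ∨ 22.01 ≤ z := by norm_num [Xex]
  obtain ⟨hne, -, hsub, -⟩ := isClustering_CexA
  intro c hc c' hc' h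
  have hnc := hne c hc
  have hnc' := hne c' hc'
  have hsc := hsub c hc
  have hsc' := hsub c' hc'
  simp only [CexA, Finset.mem_insert, Finset.mem_singleton] at hc hc'
  rcases hc with rfl | rfl | rfl <;> rcases hc' with rfl | rfl | rfl
  · exact absurd rfl h
  · exact setSparsity_lt_clusterDist_of_gap _ _ setConn_Xex hsc hsc' hnc hnc' h1 (by norm_num)
      gap1 (by norm_num)
  · exact setSparsity_lt_clusterDist_of_gap _ _ setConn_Xex hsc hsc' hnc hnc' h1 (by norm_num)
      gap1 (by norm_num)
  · exact setSparsity_lt_clusterDist_of_gap _ _ setConn_Xex hsc hsc' hnc hnc' h2 (by norm_num)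
      gap1 (by norm_num)
  · exact absurd rfl h
  · exact setSparsity_lt_clusterDist_of_gap _ _ setConn_Xex hsc hsc' hnc hnc' h2 (by norm_num)
      gap2 (by norm_num)
  · exact setSparsity_lt_clusterDist_of_gap _ _ setConn_Xex hsc hsc' hnc hnc' h3 (by norm_num)
      gap1 (by norm_num)
  · exact setSparsity_lt_clusterDist_of_gap _ _ setConn_Xex hsc hsc' hnc hnc' h3 (by norm_num)
      gap2 (by norm_num)
  · exact absurd rfl h

theorem weaklySeparable_CexB : WeaklySeparable Xex 2 CexB := by
  have h1 : SetConn Xex 2 2 {1, 3, 5} := by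
    refine setConn_insert_Xex ?_ (by simp [Xex]) (by simp [Xex]) (by norm_num) (by norm_num)
    exact setConn_pair_Xex (by simp [Xex]) (by simp [Xex]) (by norm_num) (by norm_num)
  have h2 : SetConn Xex 2 2 {7.02, 9.02, 11.02} := by
    refine setConn_insert_Xex ?_ (by simp [Xex]) (by simp [Xex]) (by norm_num) (by norm_num)
    exact setConn_pair_Xex (by simp [Xex]) (by simp [Xex]) (by norm_num) (by norm_num)
  have h3 : SetConn Xex 2 2.01 {17, 18, 19, 20, 22.01, 23.01, 24.01, 25.01} := by
    iterate 6
      refine setConn_insert_Xex ?_ (by simp [Xex]) (by simp [Xex]) (by norm_num) (by norm_num)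
    exact setConn_pair_Xex (by simp [Xex]) (by simp [Xex]) (by norm_num) (by norm_num)
  have gap1 : ∀ z ∈ Xex, z ≤ 5 ∨ 7.02 ≤ z := by norm_num [Xex]
  have gap2 : ∀ z ∈ Xex, z ≤ 11.02 ∨ 17 ≤ z := by norm_num [Xex]
  obtain ⟨hne, -, hsub, -⟩ := isClustering_CexB
  intro c hc c' hc' h
  have hnc := hne c hc
  have hnc' := hne c' hc'
  have hsc := hsub c hc
  have hsc' := hsub c' hc'
  simp only [CexB, Finset.mem_insert, Finset.mem_singleton] at hc hc'
  rcases hc with rfl | rfl | rfl <;> rcases hc' with rfl | rfl | rfl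
  · exact absurd rfl h
  · exact setSparsity_lt_clusterDist_of_gap _ _ setConn_Xex hsc hsc' hnc hnc' h1 (by norm_num)
      gap1 (by norm_num)
  · exact setSparsity_lt_clusterDist_of_gap _ _ setConn_Xex hsc hsc' hnc hnc' h1 (by norm_num)
      gap1 (by norm_num)
  · exact setSparsity_lt_clusterDist_of_gap _ _ setConn_Xex hsc hsc' hnc hnc' h2 (by norm_num)
      gap1 (by norm_num)
  · exact absurd rfl h
  · exact setSparsity_lt_clusterDist_of_gap _ _ setConn_Xex hsc hsc' hnc hnc' h2 (by norm_num)
      gap2 (by norm_num)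
  · exact setSparsity_lt_clusterDist_of_gap _ _ setConn_Xex hsc hsc' hnc hnc' h3 (by norm_num)
      gap2 (by norm_num)
  · exact setSparsity_lt_clusterDist_of_gap _ _ setConn_Xex hsc hsc' hnc hnc' h3 (by norm_num)
      gap2 (by norm_num)
  · exact absurd rfl h


/-- both CexA and CexB are weakly separable 3-clusterings of Xex for N_p = 2;
since they are distinct, Xex has no unique weakly separable 3-clustering for N_p = 2. -/
theorem stmt_16 :
    IsClustering Xex CexA ∧ IsClustering Xex CexB ∧
    CexA.card = 3 ∧ CexB.card = 3 ∧
    WeaklySeparable Xex 2 CexA ∧ WeaklySeparable Xex 2 CexB ∧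
    CexA ≠ CexB ∧
    ¬ ∃! D : Finset (Finset ℝ),
        IsClustering Xex D ∧ D.card = 3 ∧ WeaklySeparable Xex 2 D := by
  have hA := And.intro isClustering_CexA (And.intro card_CexA weaklySeparable_CexA)
  have hB := And.intro isClustering_CexB (And.intro card_CexB weaklySeparable_CexB)
  exact ⟨hA.1, hB.1, hA.2.1, hB.2.1, hA.2.2, hB.2.2, CexA_ne_CexB,
    fun h => CexA_ne_CexB (h.unique hA hB)⟩
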